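/- There exists a constant C such that for every integer 0 ≤ i ≤ 1 and all f ∈ H¹(𝕋³), g ∈ H^{i+1}(𝕋³), the product satisfies ‖fg‖_{H^i} ≤ C ‖f‖_{H¹} (‖g‖_{H^i} ‖g‖_{H^{i+1}})^{1/2}. -/

import Mathlib

open MeasureTheory

noncomputable section

/-- The fundamental cell of the torus `𝕋³ = (ℝ/ℤ)³`. -/
def cube : Set (Fin 3 → ℝ) := Set.univ.pi fun _ => Set.Ico (0 : ℝ) 1

/-- A function on `ℝ³` is `ℤ³`-periodic, i.e. descends to the torus `(ℝ/ℤ)³`. -/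
def ZPeriodic {α : Type*} (f : (Fin 3 → ℝ) → α) : Prop :=
  ∀ (y : Fin 3 → ℝ) (k : Fin 3 → ℤ), f (y + fun i => (k i : ℝ)) = f y

/-- The `H^i` Sobolev norm on the torus of a (smooth, periodic) function. -/
def Hnorm {F : Type*} [NormedAddCommGroup F] [NormedSpace ℝ F]
    (i : ℕ) (f : (Fin 3 → ℝ) → F) : ℝ :=
  Real.sqrt (∑ j ∈ Finset.range (i + 1), ∫ y in cube, ‖iteratedFDeriv ℝ j f y‖ ^ 2)

end

/-- The quantity under the square root in `Hnorm`. -/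
noncomputable def SS (k : ℕ) (f : (Fin 3 → ℝ) → ℝ) : ℝ :=
  ∑ j ∈ Finset.range (k + 1), ∫ y in cube, ‖iteratedFDeriv ℝ j f y‖ ^ 2

theorem cube_meas : MeasurableSet cube :=
  MeasurableSet.univ_pi fun _ => measurableSet_Ico

theorem cube_sub : cube ⊆ Metric.closedBall (0 : Fin 3 → ℝ) 1 := by
  intro y hy
  rw [mem_closedBall_zero_iff, pi_norm_le_iff_of_nonneg (by norm_num)]
  intro i
  have := hy i (Set.mem_univ i)
  rw [Real.norm_eq_abs, abs_le]
  constructor <;> linarith [this.1, this.2]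

theorem cont_intOn {h : (Fin 3 → ℝ) → ℝ} (hh : Continuous h) : IntegrableOn h cube :=
  (hh.continuousOn.integrableOn_compact (isCompact_closedBall 0 1)).mono_set cube_sub

theorem tile : ∃ N : ℕ, ∀ h : (Fin 3 → ℝ) → ENNReal, Measurable h → ZPeriodic h →
    ∫⁻ y in Metric.closedBall 0 4, h y ≤ N * ∫⁻ y in cube, h y := by
  let K : Finset (Fin 3 → ℤ) := Fintype.piFinset (fun _ => Finset.Icc (-5 : ℤ) 5)
  refine ⟨K.card, fun h hm hp => ?_⟩
  let T : (Fin 3 → ℤ) → Set (Fin 3 → ℝ) := fun k => (fun y => y + fun i => (k i : ℝ)) ⁻¹' cube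
  have hsub : Metric.closedBall (0 : Fin 3 → ℝ) 4 ⊆ ⋃ k ∈ K, T k := by
    intro y hy
    rw [mem_closedBall_zero_iff, pi_norm_le_iff_of_nonneg (by norm_num)] at hy
    simp only [Set.mem_iUnion]
    refine ⟨fun i => -⌊y i⌋, ?_, ?_⟩
    · rw [Fintype.mem_piFinset]
      intro i
      have h1 := abs_le.1 (hy i)
      have h2 := Int.floor_le (y i)
      have h3 := Int.lt_floor_add_one (y i)
      rw [Finset.mem_Icc]
      constructor
      · have : (⌊y i⌋ : ℝ) ≤ 5 := by linarith
        have : ⌊y i⌋ ≤ 5 := by exact_mod_cast this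
        omega
      · have : (-5 : ℝ) ≤ (⌊y i⌋ : ℝ) := by linarith
        have : -5 ≤ ⌊y i⌋ := by exact_mod_cast this
        omega
    · intro i _
      have h2 := Int.floor_le (y i)
      have h3 := Int.lt_floor_add_one (y i)
      simp only [Pi.add_apply, Set.mem_Ico]
      push_cast
      constructor <;> linarith
  have hT : ∀ k, ∫⁻ y in T k, h y = ∫⁻ y in cube, h y := by
    intro k
    have := (measurePreserving_add_right (volume : Measure (Fin 3 → ℝ))
      (fun i => (k i : ℝ))).setLIntegral_comp_preimage cube_meas hm
    rw [← this]
    exact lintegral_congr fun y => (hp y k).symm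
  calc ∫⁻ y in Metric.closedBall 0 4, h y ≤ ∫⁻ y in ⋃ k ∈ K, T k, h y :=
        lintegral_mono_set hsub
    _ ≤ ∑ k ∈ K, ∫⁻ y in T k, h y := by
        clear hsub
        induction K using Finset.induction_on with
        | empty => simp
        | insert a s ha ih =>
          rw [Finset.set_biUnion_insert, Finset.sum_insert ha]
          exact (lintegral_union_le _ _ _).trans (by gcongr)
    _ = _ := by simp [hT]

theorem per_iter {f : (Fin 3 → ℝ) → ℝ} (hp : ZPeriodic f) (k : ℕ) :
    ZPeriodic (fun y => iteratedFDeriv ℝ k f y) := by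
  intro y m
  have : (fun z => f (z + fun i => (m i : ℝ))) = f := funext fun z => hp z m
  have h2 := iteratedFDeriv_comp_add_right (𝕜 := ℝ) (f := f) k (fun i => (m i : ℝ)) y
  rw [this] at h2
  exact h2.symm

theorem cont_iter {f : (Fin 3 → ℝ) → ℝ} (hf : ContDiff ℝ (⊤ : ℕ∞) f) (k : ℕ) :
    Continuous (fun y => ‖iteratedFDeriv ℝ k f y‖) :=
  (hf.continuous_iteratedFDeriv (m := k) (by exact_mod_cast le_top)).norm

theorem SS_eq {f : (Fin 3 → ℝ) → ℝ} (hf : ContDiff ℝ (⊤ : ℕ∞) f) (k : ℕ) :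
    ∫⁻ y in cube, ENNReal.ofReal (∑ j ∈ Finset.range (k + 1), ‖iteratedFDeriv ℝ j f y‖ ^ 2)
      = ENNReal.ofReal (SS k f) := by
  rw [← ofReal_integral_eq_lintegral_ofReal, SS, integral_finsetSum]
  · exact fun i _ => cont_intOn ((cont_iter hf i).pow 2)
  · exact cont_intOn (continuous_finsetSum _ fun i _ => (cont_iter hf i).pow 2)
  · exact Filter.Eventually.of_forall fun y => by positivity

theorem SS_nonneg (k : ℕ) (f : (Fin 3 → ℝ) → ℝ) : 0 ≤ SS k f :=
  Finset.sum_nonneg fun i _ => integral_nonneg fun y => by positivity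

/-- a fixed cutoff -/
noncomputable def chi : ContDiffBump (0 : Fin 3 → ℝ) := ⟨2, 3, by norm_num, by norm_num⟩

theorem chi_smooth : ContDiff ℝ (⊤ : ℕ∞) (fun y => chi y) := chi.contDiff

theorem chi_bound : ∃ M : ℝ, 0 < M ∧ ∀ k ≤ 2, ∀ y, ‖iteratedFDeriv ℝ k (fun y => chi y) y‖ ≤ M := by
  have hk : ∀ k : ℕ, ∃ M : ℝ, ∀ y, ‖iteratedFDeriv ℝ k (fun y => chi y) y‖ ≤ M := by
    intro k
    exact (chi.hasCompactSupport.iteratedFDeriv k).exists_bound_of_continuous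
      (chi_smooth.continuous_iteratedFDeriv (m := k) (by exact_mod_cast le_top))
  choose M hM using hk
  refine ⟨|M 0| + |M 1| + |M 2| + 1, by positivity, fun k h y => ?_⟩
  have := hM k y
  interval_cases k <;> linarith [le_abs_self (M 0), le_abs_self (M 1), le_abs_self (M 2),
    abs_nonneg (M 0), abs_nonneg (M 1), abs_nonneg (M 2)]

/-- localized translate -/
noncomputable def loc (g : (Fin 3 → ℝ) → ℝ) (x y : Fin 3 → ℝ) : ℝ := chi y * g (x + y)

theorem loc_smooth {g : (Fin 3 → ℝ) → ℝ} (hg : ContDiff ℝ (⊤ : ℕ∞) g) (x : Fin 3 → ℝ) :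
    ContDiff ℝ (⊤ : ℕ∞) (loc g x) :=
  chi_smooth.mul (hg.comp (contDiff_const.add contDiff_id))

theorem loc_support (g : (Fin 3 → ℝ) → ℝ) (x : Fin 3 → ℝ) :
    tsupport (loc g x) ⊆ Metric.closedBall 0 3 := by
  have : tsupport (loc g x) ⊆ tsupport (fun y => chi y) := tsupport_mul_subset_left
  refine this.trans ?_
  have := chi.tsupport_eq
  rw [this]; exact le_rfl

theorem loc_compact (g : (Fin 3 → ℝ) → ℝ) (x : Fin 3 → ℝ) : HasCompactSupport (loc g x) :=
  (isCompact_closedBall (0 : Fin 3 → ℝ) 3).of_isClosed_subset (isClosed_tsupport _) (loc_support g x)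

theorem loc_iter_zero (g : (Fin 3 → ℝ) → ℝ) (x y : Fin 3 → ℝ) (k : ℕ)
    (hy : y ∉ Metric.closedBall (0 : Fin 3 → ℝ) 3) : iteratedFDeriv ℝ k (loc g x) y = 0 := by
  by_contra h
  exact hy (loc_support g x (support_iteratedFDeriv_subset k h))

theorem loc_bound : ∃ M : ℝ, 0 < M ∧ ∀ g, ContDiff ℝ (⊤ : ℕ∞) g → ∀ x y, ∀ k ≤ 2,
    ‖iteratedFDeriv ℝ k (loc g x) y‖ ^ 2
      ≤ M * ∑ j ∈ Finset.range (k + 1), ‖iteratedFDeriv ℝ j g (x + y)‖ ^ 2 := by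
  obtain ⟨M, hM0, hM⟩ := chi_bound
  refine ⟨12 * M ^ 2, by positivity, fun g hg x y k hk => ?_⟩
  have h1 := norm_iteratedFDeriv_mul_le (𝕜 := ℝ) (n := k) chi_smooth
    (show ContDiff ℝ (⊤ : ℕ∞) (fun y => g (x + y)) from hg.comp (contDiff_const.add contDiff_id)) y
    (by exact_mod_cast le_top)
  have h2 : ∀ j, iteratedFDeriv ℝ j (fun y => g (x + y)) y = iteratedFDeriv ℝ j g (x + y) :=
    fun j => iteratedFDeriv_comp_add_left j x y
  simp only [h2] at h1
  change ‖iteratedFDeriv ℝ k (loc g x) y‖ ≤ _ at h1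
  have hn : 0 ≤ ‖iteratedFDeriv ℝ k (loc g x) y‖ := norm_nonneg _
  have a0 := norm_nonneg (iteratedFDeriv ℝ 0 g (x + y))
  have a1 := norm_nonneg (iteratedFDeriv ℝ 1 g (x + y))
  have a2 := norm_nonneg (iteratedFDeriv ℝ 2 g (x + y))
  have c0 := hM 0 (by norm_num) y
  have c1 := hM 1 (by norm_num) y
  have c2 := hM 2 (by norm_num) y
  generalize ‖iteratedFDeriv ℝ k (loc g x) y‖ = u at *
  have key : u ≤ 2 * M * ∑ j ∈ Finset.range (k + 1), ‖iteratedFDeriv ℝ j g (x + y)‖ := by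
    refine h1.trans ?_
    interval_cases k <;> simp only [Finset.sum_range_succ, Finset.sum_range_zero, zero_add,
      Nat.choose_zero_right, Nat.choose_self, Nat.choose_one_right, Nat.cast_one, one_mul,
      Nat.sub_zero, Nat.cast_ofNat, Nat.reduceSub]
    all_goals
      generalize ‖iteratedFDeriv ℝ 0 g (x + y)‖ = p0 at *
      generalize ‖iteratedFDeriv ℝ 1 g (x + y)‖ = p1 at *
      generalize ‖iteratedFDeriv ℝ 2 g (x + y)‖ = p2 at *
      nlinarith [mul_le_mul_of_nonneg_right c0 a0, mul_le_mul_of_nonneg_right c0 a1,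
        mul_le_mul_of_nonneg_right c0 a2, mul_le_mul_of_nonneg_right c1 a0,
        mul_le_mul_of_nonneg_right c1 a1, mul_le_mul_of_nonneg_right c2 a0,
        mul_nonneg hM0.le a0, mul_nonneg hM0.le a1, mul_nonneg hM0.le a2]
  have hs : (∑ j ∈ Finset.range (k + 1), ‖iteratedFDeriv ℝ j g (x + y)‖) ^ 2 ≤
      3 * ∑ j ∈ Finset.range (k + 1), ‖iteratedFDeriv ℝ j g (x + y)‖ ^ 2 := by
    refine sq_sum_le_card_mul_sum_sq.trans ?_
    rw [Finset.card_range]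
    gcongr
    have : k + 1 ≤ 3 := by omega
    exact_mod_cast this
  calc u ^ 2 ≤ (2 * M * ∑ j ∈ Finset.range (k + 1), ‖iteratedFDeriv ℝ j g (x + y)‖) ^ 2 := by gcongr
    _ = 4 * M ^ 2 * (∑ j ∈ Finset.range (k + 1), ‖iteratedFDeriv ℝ j g (x + y)‖) ^ 2 := by ring
    _ ≤ 4 * M ^ 2 * (3 * ∑ j ∈ Finset.range (k + 1), ‖iteratedFDeriv ℝ j g (x + y)‖ ^ 2) := by gcongr
    _ = _ := by ring

theorem loc_int : ∃ C : ℝ, 0 < C ∧ ∀ g, ContDiff ℝ (⊤ : ℕ∞) g → ZPeriodic g → ∀ x : Fin 3 → ℝ,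
    ‖x‖ ≤ 1 → ∀ k ≤ 2, ∫⁻ y, ENNReal.ofReal (‖iteratedFDeriv ℝ k (loc g x) y‖ ^ 2)
      ≤ ENNReal.ofReal (C * SS k g) := by
  obtain ⟨N, hN⟩ := tile
  obtain ⟨M, hM0, hM⟩ := loc_bound
  refine ⟨M * (N + 1), by positivity, fun g hg hp x hx k hk => ?_⟩
  set H : (Fin 3 → ℝ) → ENNReal := fun y =>
    ENNReal.ofReal (∑ j ∈ Finset.range (k + 1), ‖iteratedFDeriv ℝ j g y‖ ^ 2) with hH
  have Hm : Measurable H := by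
    have : Continuous (fun y => ∑ j ∈ Finset.range (k + 1), ‖iteratedFDeriv ℝ j g y‖ ^ 2) :=
      continuous_finsetSum _ fun i _ => (cont_iter hg i).pow 2
    exact this.measurable.ennreal_ofReal
  have Hp : ZPeriodic H := by
    intro y m
    simp only [hH]
    congr 1
    refine Finset.sum_congr rfl fun j _ => ?_
    have := per_iter hp j y m
    simp only at this
    rw [this]
  have e1 : ∀ y, ENNReal.ofReal (‖iteratedFDeriv ℝ k (loc g x) y‖ ^ 2) ≤
      ENNReal.ofReal M * (Metric.closedBall 0 4).indicator H (x + y) := by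
    intro y
    by_cases hy : y ∈ Metric.closedBall (0 : Fin 3 → ℝ) 3
    · have : x + y ∈ Metric.closedBall (0 : Fin 3 → ℝ) 4 := by
        rw [mem_closedBall_zero_iff] at *
        linarith [norm_add_le x y]
      rw [Set.indicator_of_mem this, hH, ← ENNReal.ofReal_mul hM0.le]
      exact ENNReal.ofReal_le_ofReal (hM g hg x y k hk)
    · rw [loc_iter_zero g x y k hy]; simp
  calc _ ≤ ∫⁻ y, ENNReal.ofReal M * (Metric.closedBall 0 4).indicator H (x + y) := lintegral_mono e1
    _ = ENNReal.ofReal M * ∫⁻ y in Metric.closedBall 0 4, H y := by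
      rw [lintegral_const_mul' _ _ ENNReal.ofReal_ne_top,
        lintegral_add_left_eq_self (μ := volume) ((Metric.closedBall 0 4).indicator H) x,
        lintegral_indicator Metric.isClosed_closedBall.measurableSet]
    _ ≤ ENNReal.ofReal M * (N * ∫⁻ y in cube, H y) := by gcongr; exact hN H Hm Hp
    _ = ENNReal.ofReal M * (N * ENNReal.ofReal (SS k g)) := by rw [hH, SS_eq hg]
    _ = ENNReal.ofReal (M * (N * SS k g)) := by
      rw [ENNReal.ofReal_mul hM0.le, ENNReal.ofReal_mul (by positivity), ENNReal.ofReal_natCast]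
    _ ≤ _ := by
      apply ENNReal.ofReal_le_ofReal
      have := SS_nonneg k g
      nlinarith [mul_nonneg hM0.le this]

theorem hardy1 {R : ℝ} (hR : 0 ≤ R) {p dp : ℝ → ℝ} (hd : ∀ r, HasDerivAt p (dp r) r)
    (hc : Continuous dp) (h0 : p R = 0) :
    ∫ r in (0 : ℝ)..R, p r ^ 2 ≤ 4 * ∫ r in (0 : ℝ)..R, r ^ 2 * dp r ^ 2 := by
  have hp : Continuous p := continuous_iff_continuousAt.2 fun r => (hd r).continuousAt
  have e : ∫ r in (0 : ℝ)..R, (p r ^ 2 + r * (2 * p r * dp r)) = 0 := by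
    rw [intervalIntegral.integral_eq_sub_of_hasDerivAt (f := fun r => r * p r ^ 2)]
    · simp [h0]
    · intro r _
      have := (hasDerivAt_id r).mul ((hd r).pow 2)
      exact this.congr_deriv (by simp)
    · exact Continuous.intervalIntegrable (by fun_prop) _ _
  have m : ∫ r in (0 : ℝ)..R, ((1 / 2) * p r ^ 2 - 2 * (r ^ 2 * dp r ^ 2)) ≤
      ∫ r in (0 : ℝ)..R, (p r ^ 2 + r * (2 * p r * dp r)) := by
    apply intervalIntegral.integral_mono_on hR
    · exact Continuous.intervalIntegrable (by fun_prop) _ _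
    · exact Continuous.intervalIntegrable (by fun_prop) _ _
    · intro r _
      nlinarith [sq_nonneg (p r + 2 * (r * dp r))]
  rw [e, intervalIntegral.integral_sub (Continuous.intervalIntegrable (by fun_prop) _ _)
    (Continuous.intervalIntegrable (by fun_prop) _ _), intervalIntegral.integral_const_mul,
    intervalIntegral.integral_const_mul] at m
  linarith

theorem ray {R t : ℝ} (hR : 0 ≤ R) (ht : 0 < t) {p dp ddp : ℝ → ℝ}
    (hd : ∀ r, HasDerivAt p (dp r) r) (hd' : ∀ r, HasDerivAt dp (ddp r) r)
    (hc : Continuous ddp) (h0 : p R = 0) (h0' : dp R = 0) :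
    p 0 ^ 2 ≤ ∫ r in (0 : ℝ)..R, r ^ 2 * (4 * (t * dp r ^ 2 + t⁻¹ * ddp r ^ 2)) := by
  have hp : Continuous p := continuous_iff_continuousAt.2 fun r => (hd r).continuousAt
  have hp' : Continuous dp := continuous_iff_continuousAt.2 fun r => (hd' r).continuousAt
  have A := hardy1 hR hd hp' h0
  have B := hardy1 hR hd' hc h0'
  have e : ∫ r in (0 : ℝ)..R, (2 * p r * dp r) = - p 0 ^ 2 := by
    rw [intervalIntegral.integral_eq_sub_of_hasDerivAt (f := fun r => p r ^ 2)]
    · simp [h0]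
    · intro r _
      have := (hd r).pow 2
      exact this.congr_deriv (by simp)
    · exact Continuous.intervalIntegrable (by fun_prop) _ _
  have m : ∫ r in (0 : ℝ)..R, (-(t * p r ^ 2) - t⁻¹ * dp r ^ 2) ≤
      ∫ r in (0 : ℝ)..R, (2 * p r * dp r) := by
    apply intervalIntegral.integral_mono_on hR
    · exact Continuous.intervalIntegrable (by fun_prop) _ _
    · exact Continuous.intervalIntegrable (by fun_prop) _ _
    · intro r _
      have h1 : t * p r ^ 2 + t⁻¹ * dp r ^ 2 + 2 * p r * dp r = t⁻¹ * (t * p r + dp r) ^ 2 := by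
        field_simp
        ring
      have h2 : 0 ≤ t⁻¹ * (t * p r + dp r) ^ 2 := by positivity
      linarith
  rw [e, intervalIntegral.integral_sub (Continuous.intervalIntegrable (by fun_prop) _ _)
    (Continuous.intervalIntegrable (by fun_prop) _ _), intervalIntegral.integral_neg,
    intervalIntegral.integral_const_mul,
    intervalIntegral.integral_const_mul] at m
  have s : ∫ r in (0 : ℝ)..R, r ^ 2 * (4 * (t * dp r ^ 2 + t⁻¹ * ddp r ^ 2)) =
      t * (4 * ∫ r in (0 : ℝ)..R, r ^ 2 * dp r ^ 2) +
        t⁻¹ * (4 * ∫ r in (0 : ℝ)..R, r ^ 2 * ddp r ^ 2) := by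
    rw [← intervalIntegral.integral_const_mul, ← intervalIntegral.integral_const_mul,
      ← intervalIntegral.integral_const_mul, ← intervalIntegral.integral_const_mul,
      ← intervalIntegral.integral_add (Continuous.intervalIntegrable (by fun_prop) _ _)
      (Continuous.intervalIntegrable (by fun_prop) _ _)]
    congr 1
    ext r
    ring
  rw [s]
  have := mul_le_mul_of_nonneg_left A ht.le
  have := mul_le_mul_of_nonneg_left B (inv_pos.2 ht).le
  linarith

theorem polar (H : (Fin 3 → ℝ) → ENNReal) (hH : Measurable H) :
    ∫⁻ y, H y = ∫⁻ w, (∫⁻ r in Set.Ioi (0 : ℝ), ENNReal.ofReal (r ^ 2) * H (r • w.1))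
      ∂(volume : Measure (Fin 3 → ℝ)).toSphere := by
  have h1 : ∫⁻ y, H y = ∫⁻ y : ({(0)}ᶜ : Set (Fin 3 → ℝ)), H y
      ∂((volume : Measure (Fin 3 → ℝ)).comap (↑)) := by
    rw [lintegral_subtype_comap (measurableSet_singleton _).compl, restrict_compl_singleton]
  have h2 := ((volume : Measure (Fin 3 → ℝ)).measurePreserving_homeomorphUnitSphereProd).symm
    (homeomorphUnitSphereProd (Fin 3 → ℝ)).toMeasurableEquiv
  have h3 := h2.lintegral_comp (f := fun y => H y.1) (hH.comp measurable_subtype_coe)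
  rw [h1, ← h3, lintegral_prod]
  · refine lintegral_congr fun w => ?_
    have hm : Measurable fun r : ℝ => H (r • w.1) := hH.comp (by fun_prop)
    rw [Measure.volumeIoiPow, lintegral_withDensity_eq_lintegral_mul _ (by fun_prop)]
    · have h4 := lintegral_subtype_comap (μ := (volume : Measure ℝ)) (measurableSet_Ioi (a := (0 : ℝ)))
        (fun r => ENNReal.ofReal (r ^ 2) * H (r • w.1))
      rw [← h4]
      refine lintegral_congr fun r => ?_
      simp
    · exact hm.comp measurable_subtype_coe
  · refine Measurable.aemeasurable ?_
    exact (hH.comp measurable_subtype_coe).comp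
      (homeomorphUnitSphereProd (Fin 3 → ℝ)).toMeasurableEquiv.symm.measurable

theorem agmon0 : ∃ C : ℝ, 0 < C ∧ ∀ u : (Fin 3 → ℝ) → ℝ, ContDiff ℝ (⊤ : ℕ∞) u →
    tsupport u ⊆ Metric.closedBall 0 3 → ∀ t : ℝ, 0 < t →
    ENNReal.ofReal (C * u 0 ^ 2) ≤ ENNReal.ofReal (4 * t) * (∫⁻ y, ENNReal.ofReal (‖iteratedFDeriv ℝ 1 u y‖ ^ 2)) +
     ENNReal.ofReal (4 * t⁻¹) * ∫⁻ y, ENNReal.ofReal (‖iteratedFDeriv ℝ 2 u y‖ ^ 2) := by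
  set σ := (volume : Measure (Fin 3 → ℝ)).toSphere with hσ
  have hpos : 0 < (σ Set.univ).toReal :=
    ENNReal.toReal_pos (by rw [Ne, Measure.measure_univ_eq_zero]; exact Measure.toSphere_ne_zero _)
      (measure_ne_top _ _)
  refine ⟨(σ Set.univ).toReal, hpos, fun u hu hs t ht => ?_⟩
  set G : (Fin 3 → ℝ) → ℝ := fun y =>
    4 * (t * ‖iteratedFDeriv ℝ 1 u y‖ ^ 2 + t⁻¹ * ‖iteratedFDeriv ℝ 2 u y‖ ^ 2) with hG
  have c1 := cont_iter hu 1
  have c2 := cont_iter hu 2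
  have Gc : Continuous G := by fun_prop
  have hi : ∫⁻ y, ENNReal.ofReal (G y) =
      ENNReal.ofReal (4 * t) * (∫⁻ y, ENNReal.ofReal (‖iteratedFDeriv ℝ 1 u y‖ ^ 2)) +
     ENNReal.ofReal (4 * t⁻¹) * ∫⁻ y, ENNReal.ofReal (‖iteratedFDeriv ℝ 2 u y‖ ^ 2) := by
    rw [← lintegral_const_mul' _ _ ENNReal.ofReal_ne_top,
      ← lintegral_const_mul' _ _ ENNReal.ofReal_ne_top, ← lintegral_add_left]
    · refine lintegral_congr fun y => ?_
      rw [← ENNReal.ofReal_mul (by positivity), ← ENNReal.ofReal_mul (by positivity),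
        ← ENNReal.ofReal_add (by positivity) (by positivity)]
      congr 1
      simp only [hG]
      ring
    · exact (c1.pow 2).measurable.ennreal_ofReal.const_mul _
  rw [← hi, polar _ Gc.measurable.ennreal_ofReal, ENNReal.ofReal_mul ENNReal.toReal_nonneg,
    ENNReal.ofReal_toReal (measure_ne_top _ _), mul_comm, ← lintegral_const]
  refine lintegral_mono fun w => ?_
  have hw : ‖w.1‖ = 1 := by simp
  have d1 : Differentiable ℝ u := hu.differentiable (by simp)
  have hu1 : ContDiff ℝ (⊤ : ℕ∞) (fderiv ℝ u) := hu.fderiv_right (by simp)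
  have d2 : Differentiable ℝ (fderiv ℝ u) := hu1.differentiable (by simp)
  have hu2 : ContDiff ℝ (⊤ : ℕ∞) (fderiv ℝ (fderiv ℝ u)) := hu1.fderiv_right (by simp)
  have hc2 : Continuous (fderiv ℝ (fderiv ℝ u)) := hu2.continuous
  have hline : ∀ r : ℝ, HasDerivAt (fun r : ℝ => r • w.1) w.1 r := fun r => by
    simpa using (hasDerivAt_id r).smul_const w.1
  have hout : (4 : ℝ) • w.1 ∉ Metric.closedBall (0 : Fin 3 → ℝ) 3 := by
    rw [mem_closedBall_zero_iff, norm_smul, hw]; norm_num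
  have R := ray (R := 4) (t := t) (by norm_num) ht (p := fun r => u (r • w.1))
    (dp := fun r => fderiv ℝ u (r • w.1) w.1)
    (ddp := fun r => fderiv ℝ (fderiv ℝ u) (r • w.1) w.1 w.1)
    (fun r => (d1 _).hasFDerivAt.comp_hasDerivAt r (hline r))
    (fun r => by
      have : HasDerivAt (fun r : ℝ => fderiv ℝ u (r • w.1))
          (fderiv ℝ (fderiv ℝ u) (r • w.1) w.1) r :=
        (d2 (r • w.1)).hasFDerivAt.comp_hasDerivAt r (hline r)
      simpa using this.clm_apply (hasDerivAt_const r w.1))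
    (by fun_prop)
    (by
      by_contra h
      exact hout (hs (subset_tsupport u h)))
    (by
      have : fderiv ℝ u ((4 : ℝ) • w.1) = 0 := by
        by_contra h
        exact hout (hs (support_fderiv_subset ℝ h))
      simp [this])
  simp only [zero_smul] at R
  have R2 : u 0 ^ 2 ≤ ∫ r in (0 : ℝ)..4, r ^ 2 * G (r • w.1) := by
    refine R.trans ?_
    apply intervalIntegral.integral_mono_on (by norm_num)
    · have hc1 := hu1.continuous
      exact Continuous.intervalIntegrable (by fun_prop) _ _
    · exact Continuous.intervalIntegrable (by fun_prop) _ _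
    · intro r _
      have b1 : (fderiv ℝ u (r • w.1) w.1) ^ 2 ≤ ‖iteratedFDeriv ℝ 1 u (r • w.1)‖ ^ 2 := by
        rw [norm_iteratedFDeriv_one, sq_le_sq, abs_norm]
        simpa [hw] using (fderiv ℝ u (r • w.1)).le_opNorm w.1
      have b2 : (fderiv ℝ (fderiv ℝ u) (r • w.1) w.1 w.1) ^ 2 ≤
          ‖iteratedFDeriv ℝ 2 u (r • w.1)‖ ^ 2 := by
        rw [← norm_iteratedFDeriv_fderiv, norm_iteratedFDeriv_one, sq_le_sq, abs_norm]
        simpa [hw] using (fderiv ℝ (fderiv ℝ u) (r • w.1)).le_opNorm₂ w.1 w.1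
      simp only [hG]
      gcongr
  have Gn : ∀ y, 0 ≤ G y := fun y => by simp only [hG]; positivity
  calc ENNReal.ofReal (u 0 ^ 2) ≤ ENNReal.ofReal (∫ r in (0 : ℝ)..4, r ^ 2 * G (r • w.1)) :=
        ENNReal.ofReal_le_ofReal R2
    _ = ∫⁻ r in Set.Ioc (0 : ℝ) 4, ENNReal.ofReal (r ^ 2 * G (r • w.1)) := by
        rw [intervalIntegral.integral_of_le (by norm_num), ofReal_integral_eq_lintegral_ofReal]
        · exact (Continuous.integrableOn_Icc (by fun_prop)).mono_set Set.Ioc_subset_Icc_self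
        · exact Filter.Eventually.of_forall fun r => mul_nonneg (sq_nonneg r) (Gn _)
    _ ≤ ∫⁻ r in Set.Ioi (0 : ℝ), ENNReal.ofReal (r ^ 2 * G (r • w.1)) :=
        lintegral_mono_set Set.Ioc_subset_Ioi_self
    _ = _ := by
        refine lintegral_congr fun r => ?_
        rw [ENNReal.ofReal_mul (sq_nonneg r)]

theorem agmon1 : ∃ C : ℝ, 0 < C ∧ ∀ g, ContDiff ℝ (⊤ : ℕ∞) g → ZPeriodic g → ∀ x : Fin 3 → ℝ,
    ‖x‖ ≤ 1 → ∀ t : ℝ, 0 < t → g x ^ 2 ≤ C * (t * SS 1 g + t⁻¹ * SS 2 g) := by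
  obtain ⟨c, hc, h⟩ := agmon0
  obtain ⟨K, hK, hk⟩ := loc_int
  refine ⟨c⁻¹ * (4 * K), by positivity, fun g hg hp x hx t ht => ?_⟩
  have a := h (loc g x) (loc_smooth hg x) (loc_support g x) t ht
  have h0 : loc g x 0 = g x := by
    have : chi (0 : Fin 3 → ℝ) = 1 := chi.one_of_mem_closedBall (Metric.mem_closedBall_self chi.rIn_pos.le)
    simp [loc, this]
  have n1 := SS_nonneg 1 g
  have n2 := SS_nonneg 2 g
  have b : ENNReal.ofReal (c * g x ^ 2) ≤
      ENNReal.ofReal (4 * t * (K * SS 1 g) + 4 * t⁻¹ * (K * SS 2 g)) := by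
    rw [ENNReal.ofReal_add (by positivity) (by positivity), ENNReal.ofReal_mul (by positivity : 0 ≤ 4 * t),
      ENNReal.ofReal_mul (by positivity : 0 ≤ 4 * t⁻¹), ← h0]
    refine a.trans ?_
    gcongr
    · exact hk g hg hp x hx 1 (by norm_num)
    · exact hk g hg hp x hx 2 (by norm_num)
  have b' := (ENNReal.ofReal_le_ofReal_iff (by positivity)).1 b
  calc g x ^ 2 = c⁻¹ * (c * g x ^ 2) := by field_simp
    _ ≤ c⁻¹ * (4 * t * (K * SS 1 g) + 4 * t⁻¹ * (K * SS 2 g)) := by gcongr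
    _ = _ := by ring

theorem opt {a x y : ℝ} (hx : 0 ≤ x) (hy : 0 ≤ y) (h : ∀ t : ℝ, 0 < t → a ≤ t * x + t⁻¹ * y) :
    a ≤ 2 * Real.sqrt (x * y) := by
  refine le_of_forall_pos_le_add fun e he => ?_
  have key : ∀ d : ℝ, 0 < d → a ≤ 2 * Real.sqrt ((x + d) * (y + d)) := by
    intro d hd
    have hx' : 0 < x + d := by linarith
    have hy' : 0 < y + d := by linarith
    have p := Real.sqrt_pos.2 hx'
    have q := Real.sqrt_pos.2 hy'
    have := h (Real.sqrt (y + d) / Real.sqrt (x + d)) (by positivity)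
    rw [Real.sqrt_mul hx'.le]
    have e1 : Real.sqrt (y + d) / Real.sqrt (x + d) * (x + d) = Real.sqrt (x + d) * Real.sqrt (y + d) := by
      nth_rewrite 2 [← Real.mul_self_sqrt hx'.le]
      field_simp
    have e2 : (Real.sqrt (y + d) / Real.sqrt (x + d))⁻¹ * (y + d) = Real.sqrt (x + d) * Real.sqrt (y + d) := by
      nth_rewrite 2 [← Real.mul_self_sqrt hy'.le]
      field_simp
    have f1 : 0 < Real.sqrt (y + d) / Real.sqrt (x + d) := by positivity
    have f2 := inv_pos.2 f1
    nlinarith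
  have hl : Filter.Tendsto (fun d : ℝ => 2 * Real.sqrt ((x + d) * (y + d))) (nhdsWithin 0 (Set.Ioi 0))
      (nhds (2 * Real.sqrt (x * y))) := by
    have : Continuous (fun d : ℝ => 2 * Real.sqrt ((x + d) * (y + d))) := by fun_prop
    have h2 := this.tendsto 0
    simp only [add_zero] at h2
    exact h2.mono_left nhdsWithin_le_nhds
  have := ge_of_tendsto hl (Filter.eventually_of_mem self_mem_nhdsWithin fun d hd => key d hd)
  linarith

theorem agmon : ∃ C : ℝ, 0 < C ∧ ∀ g, ContDiff ℝ (⊤ : ℕ∞) g → ZPeriodic g → ∀ x : Fin 3 → ℝ,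
    ‖x‖ ≤ 1 → g x ^ 2 ≤ C * Real.sqrt (SS 1 g * SS 2 g) := by
  obtain ⟨C, hC, h⟩ := agmon1
  refine ⟨2 * C, by positivity, fun g hg hp x hx => ?_⟩
  have := opt (a := g x ^ 2 / C) (SS_nonneg 1 g) (SS_nonneg 2 g) fun t ht => by
    rw [div_le_iff₀ hC, mul_comm]
    exact h g hg hp x hx t ht
  rw [div_le_iff₀ hC] at this
  linarith

theorem L6 : ∃ C : ℝ, 0 < C ∧ ∀ f, ContDiff ℝ (⊤ : ℕ∞) f → ZPeriodic f →
    ∫⁻ y in cube, ‖f y‖ₑ ^ (6 : ℝ) ≤ ENNReal.ofReal (C * SS 1 f ^ 3) := by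
  obtain ⟨K, hK, hk⟩ := loc_int
  set c : NNReal := eLpNormLESNormFDerivOfEqInnerConst (volume : Measure (Fin 3 → ℝ)) (2 : NNReal) with hc
  refine ⟨((c : ℝ) ^ 6 + 1) * K ^ 3, by positivity, fun f hf hp => ?_⟩
  have S := eLpNorm_le_eLpNorm_fderiv_of_eq_inner (volume : Measure (Fin 3 → ℝ)) (u := loc f 0)
    ((loc_smooth hf 0).of_le (by exact_mod_cast le_top)) (loc_compact f 0) (p := 2) (p' := 6)
    (by norm_num) (by simp) (by simp; norm_num)
  rw [← hc] at S
  have e6 := eLpNorm_nnreal_pow_eq_lintegral (μ := (volume : Measure (Fin 3 → ℝ)))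
    (f := loc f 0) (p := 6) (by norm_num)
  have e2 := eLpNorm_nnreal_pow_eq_lintegral (μ := (volume : Measure (Fin 3 → ℝ)))
    (f := fderiv ℝ (loc f 0)) (p := 2) (by norm_num)
  have i2 : ∫⁻ y, ‖fderiv ℝ (loc f 0) y‖ₑ ^ ((2 : NNReal) : ℝ) ≤ ENNReal.ofReal (K * SS 1 f) := by
    refine le_trans (le_of_eq ?_) (hk f hf hp 0 (by simp) 1 (by norm_num))
    refine lintegral_congr fun y => ?_
    rw [norm_iteratedFDeriv_one, ENNReal.ofReal_pow (norm_nonneg _), ofReal_norm]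
    norm_num
  rw [← e2] at i2
  calc ∫⁻ y in cube, ‖f y‖ₑ ^ (6 : ℝ) = ∫⁻ y in cube, ‖loc f 0 y‖ₑ ^ (6 : ℝ) := by
        refine setLIntegral_congr_fun cube_meas fun y hy => ?_
        have : chi y = 1 := chi.one_of_mem_closedBall
          (Metric.closedBall_subset_closedBall (by norm_num [chi]) (cube_sub hy))
        simp [loc, this]
    _ ≤ ∫⁻ y, ‖loc f 0 y‖ₑ ^ (6 : ℝ) := setLIntegral_le_lintegral _ _
    _ = eLpNorm (loc f 0) ((6 : NNReal)) volume ^ ((6 : NNReal) : ℝ) := by rw [e6]; norm_num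
    _ ≤ (c * eLpNorm (fderiv ℝ (loc f 0)) ((2 : NNReal)) volume) ^ ((6 : NNReal) : ℝ) := by
        gcongr
    _ = c ^ 6 * (eLpNorm (fderiv ℝ (loc f 0)) ((2 : NNReal)) volume ^ ((2 : NNReal) : ℝ)) ^ 3 := by
        rw [show ((6 : NNReal) : ℝ) = ((6 : ℕ) : ℝ) by norm_num,
          show ((2 : NNReal) : ℝ) = ((2 : ℕ) : ℝ) by norm_num, ENNReal.rpow_natCast,
          ENNReal.rpow_natCast]
        ring
    _ ≤ c ^ 6 * (ENNReal.ofReal (K * SS 1 f)) ^ 3 := by gcongr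
    _ = ENNReal.ofReal ((c : ℝ) ^ 6 * (K * SS 1 f) ^ 3) := by
        have := SS_nonneg 1 f
        rw [ENNReal.ofReal_mul (p := (c : ℝ) ^ 6) (by positivity), ENNReal.ofReal_pow (by positivity),
          ENNReal.ofReal_pow (by positivity), ENNReal.ofReal_coe_nnreal]
    _ ≤ _ := by
        apply ENNReal.ofReal_le_ofReal
        have := SS_nonneg 1 f
        have : 0 ≤ K ^ 3 * SS 1 f ^ 3 := by positivity
        nlinarith

theorem SS0 (g : (Fin 3 → ℝ) → ℝ) : SS 0 g = ∫ y in cube, g y ^ 2 := by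
  simp [SS]

theorem est0 : ∃ C : ℝ, 0 < C ∧ ∀ f g, ContDiff ℝ (⊤ : ℕ∞) f → ZPeriodic f →
    ContDiff ℝ (⊤ : ℕ∞) g → ZPeriodic g →
    ∫ y in cube, f y ^ 2 * g y ^ 2 ≤ C * SS 1 f * Real.sqrt (SS 0 g * SS 1 g) := by
  obtain ⟨C, hC, h6⟩ := L6
  refine ⟨C ^ (1 / 3 : ℝ) * C ^ (1 / 6 : ℝ), by positivity, fun f g hf hfp hg hgp => ?_⟩
  have nf := SS_nonneg 1 f
  have n0 := SS_nonneg 0 g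
  have n1 := SS_nonneg 1 g
  have hfc := hf.continuous
  have hgc := hg.continuous
  have H := ENNReal.lintegral_prod_norm_pow_le (μ := volume.restrict cube) (Finset.univ : Finset (Fin 3))
    (f := ![fun y => ‖f y‖ₑ ^ (6 : ℝ), fun y => ‖g y‖ₑ ^ (2 : ℝ), fun y => ‖g y‖ₑ ^ (6 : ℝ)])
    (p := ![1 / 3, 1 / 2, 1 / 6])
    (by
      intro i _
      fin_cases i
      · exact (hfc.enorm.measurable.pow_const _).aemeasurable
      · exact (hgc.enorm.measurable.pow_const _).aemeasurable
      · exact (hgc.enorm.measurable.pow_const _).aemeasurable)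
    (by simp [Fin.sum_univ_three]; norm_num)
    (by intro i _; fin_cases i <;> norm_num)
  simp only [Fin.prod_univ_three, Matrix.cons_val_zero, Matrix.cons_val_one, Matrix.cons_val] at H
  have g2 : ∫⁻ y in cube, ‖g y‖ₑ ^ (2 : ℝ) = ENNReal.ofReal (SS 0 g) := by
    rw [← SS_eq hg]
    refine lintegral_congr fun y => ?_
    simp [← ofReal_norm, ← ENNReal.ofReal_pow]
  have L : ENNReal.ofReal (∫ y in cube, f y ^ 2 * g y ^ 2) =
      ∫⁻ y in cube, (‖f y‖ₑ ^ (6 : ℝ)) ^ (1 / 3 : ℝ) * (‖g y‖ₑ ^ (2 : ℝ)) ^ (1 / 2 : ℝ) *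
        (‖g y‖ₑ ^ (6 : ℝ)) ^ (1 / 6 : ℝ) := by
    rw [ofReal_integral_eq_lintegral_ofReal (cont_intOn (by fun_prop))
      (Filter.Eventually.of_forall fun y => by positivity)]
    refine lintegral_congr fun y => ?_
    rw [← ENNReal.rpow_mul, ← ENNReal.rpow_mul, ← ENNReal.rpow_mul,
      show (6 : ℝ) * (1 / 3) = ((2 : ℕ) : ℝ) by norm_num, ENNReal.rpow_natCast,
      show (2 : ℝ) * (1 / 2) = 1 by norm_num, show (6 : ℝ) * (1 / 6) = 1 by norm_num,
      ENNReal.rpow_one, ← sq_abs (f y), ← sq_abs (g y), ENNReal.ofReal_mul (by positivity),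
      ENNReal.ofReal_pow (abs_nonneg _), ENNReal.ofReal_pow (abs_nonneg _),
      ← Real.enorm_eq_ofReal_abs, ← Real.enorm_eq_ofReal_abs]
    ring
  rw [← L, g2] at H
  have R : ENNReal.ofReal (∫ y in cube, f y ^ 2 * g y ^ 2) ≤
      ENNReal.ofReal ((C * SS 1 f ^ 3) ^ (1 / 3 : ℝ) * (SS 0 g) ^ (1 / 2 : ℝ) *
        (C * SS 1 g ^ 3) ^ (1 / 6 : ℝ)) := by
    rw [ENNReal.ofReal_mul (by positivity), ENNReal.ofReal_mul (by positivity),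
      ← ENNReal.ofReal_rpow_of_nonneg (by positivity) (by positivity),
      ← ENNReal.ofReal_rpow_of_nonneg (by positivity) (by positivity),
      ← ENNReal.ofReal_rpow_of_nonneg (by positivity) (by positivity)]
    refine H.trans ?_
    gcongr
    · exact h6 f hf hfp
    · exact h6 g hg hgp
  have R' := (ENNReal.ofReal_le_ofReal_iff (by positivity)).1 R
  refine R'.trans (le_of_eq ?_)
  rw [Real.mul_rpow hC.le (by positivity), Real.mul_rpow hC.le (by positivity),
    ← Real.rpow_natCast, ← Real.rpow_natCast, ← Real.rpow_mul nf, ← Real.rpow_mul n1,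
    Real.sqrt_eq_rpow, Real.mul_rpow n0 n1]
  norm_num
  ring

theorem pd_smooth {g : (Fin 3 → ℝ) → ℝ} (hg : ContDiff ℝ (⊤ : ℕ∞) g) (v : Fin 3 → ℝ) :
    ContDiff ℝ (⊤ : ℕ∞) (fun y => fderiv ℝ g y v) :=
  (hg.fderiv_right (m := (⊤ : ℕ∞)) (by simp)).clm_apply contDiff_const

theorem pd_per {g : (Fin 3 → ℝ) → ℝ} (hp : ZPeriodic g) (v : Fin 3 → ℝ) :
    ZPeriodic (fun y => fderiv ℝ g y v) := by
  intro y m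
  have : (fun z => g (z + fun i => (m i : ℝ))) = g := funext fun z => hp z m
  have h2 := fderiv_comp_add_right (𝕜 := ℝ) (f := g) (x := y) (fun i => (m i : ℝ))
  rw [this] at h2
  simp only [h2]

theorem pd_SS {g : (Fin 3 → ℝ) → ℝ} (hg : ContDiff ℝ (⊤ : ℕ∞) g) {v : Fin 3 → ℝ} (hv : ‖v‖ ≤ 1) :
    SS 0 (fun y => fderiv ℝ g y v) ≤ SS 1 g ∧ SS 1 (fun y => fderiv ℝ g y v) ≤ SS 2 g := by
  have hs := pd_smooth hg v
  have q0 : ∫ y in cube, ‖iteratedFDeriv ℝ 0 (fun y => fderiv ℝ g y v) y‖ ^ 2 ≤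
      ∫ y in cube, ‖iteratedFDeriv ℝ 1 g y‖ ^ 2 := by
    refine setIntegral_mono (cont_intOn ((cont_iter hs 0).pow 2)) (cont_intOn ((cont_iter hg 1).pow 2))
      fun y => ?_
    simp only [norm_iteratedFDeriv_zero, norm_iteratedFDeriv_one]
    gcongr
    exact (fderiv ℝ g y).unit_le_opNorm v hv
  have q1 : ∫ y in cube, ‖iteratedFDeriv ℝ 1 (fun y => fderiv ℝ g y v) y‖ ^ 2 ≤
      ∫ y in cube, ‖iteratedFDeriv ℝ 2 g y‖ ^ 2 := by
    refine setIntegral_mono (cont_intOn ((cont_iter hs 1).pow 2)) (cont_intOn ((cont_iter hg 2).pow 2))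
      fun y => ?_
    have hd : DifferentiableAt ℝ (fderiv ℝ g) y :=
      (hg.fderiv_right (m := (⊤ : ℕ∞)) (by simp)).differentiable (by simp) y
    simp only [norm_iteratedFDeriv_one]
    rw [← norm_iteratedFDeriv_fderiv, norm_iteratedFDeriv_one]
    gcongr
    refine ContinuousLinearMap.opNorm_le_bound _ (norm_nonneg _) fun z => ?_
    have : fderiv ℝ (fun y => fderiv ℝ g y v) y z = fderiv ℝ (fderiv ℝ g) y z v := by
      rw [fderiv_clm_apply hd (differentiableAt_const v)]
      simp
    rw [this]
    refine ((fderiv ℝ (fderiv ℝ g) y).le_opNorm₂ z v).trans ?_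
    have := mul_nonneg (norm_nonneg (fderiv ℝ (fderiv ℝ g) y)) (norm_nonneg z)
    nlinarith
  have p0 : 0 ≤ ∫ y in cube, ‖iteratedFDeriv ℝ 0 g y‖ ^ 2 := integral_nonneg fun y => by positivity
  simp only [SS, Finset.sum_range_succ, Finset.sum_range_zero, zero_add]
  constructor <;> linarith

theorem grad_le (L : (Fin 3 → ℝ) →L[ℝ] ℝ) :
    ‖L‖ ^ 2 ≤ 3 * ∑ i : Fin 3, L (Pi.single i 1) ^ 2 := by
  have h1 : ‖L‖ ≤ ∑ i : Fin 3, |L (Pi.single i 1)| := by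
    refine ContinuousLinearMap.opNorm_le_bound _ (Finset.sum_nonneg fun i _ => abs_nonneg _) fun z => ?_
    have : L z = ∑ i : Fin 3, z i * L (Pi.single i 1) := by
      have := L.toLinearMap.pi_apply_eq_sum_univ z
      rw [ContinuousLinearMap.coe_coe] at this
      rw [this]
      refine Finset.sum_congr rfl fun i _ => ?_
      rw [smul_eq_mul]
      congr 2
      ext j
      simp [Pi.single_apply, eq_comm]
    rw [this, Finset.sum_mul]
    refine (norm_sum_le _ _).trans (Finset.sum_le_sum fun i _ => ?_)
    rw [norm_mul, mul_comm, Real.norm_eq_abs (L _)]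
    gcongr
    exact norm_le_pi_norm z i
  calc ‖L‖ ^ 2 ≤ (∑ i : Fin 3, |L (Pi.single i 1)|) ^ 2 := by gcongr
    _ ≤ _ := sq_sum_le_card_mul_sum_sq
    _ = _ := by simp

theorem final_sq : ∃ C : ℝ, 0 < C ∧ ∀ i : ℕ, i ≤ 1 → ∀ f g : (Fin 3 → ℝ) → ℝ,
      ContDiff ℝ (⊤ : ℕ∞) f → ZPeriodic f → ContDiff ℝ (⊤ : ℕ∞) g → ZPeriodic g →
      SS i (fun y => f y * g y) ≤ C * SS 1 f * Real.sqrt (SS i g * SS (i + 1) g) := by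
  obtain ⟨A, hA, ha⟩ := agmon
  obtain ⟨B, hB, hb⟩ := est0
  refine ⟨B + 18 * B + 2 * A, by positivity, fun i hi f g hf hfp hg hgp => ?_⟩
  have nf := SS_nonneg 1 f
  have e0 : SS 0 (fun y => f y * g y) ≤ B * SS 1 f * Real.sqrt (SS 0 g * SS 1 g) := by
    rw [SS0]
    simp only [mul_pow]
    exact hb f g hf hfp hg hgp
  have hfg : ContDiff ℝ (⊤ : ℕ∞) (fun y => f y * g y) := hf.mul hg
  have hle : i = 0 ∨ i = 1 := by omega
  rcases hle with rfl | rfl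
  · refine e0.trans ?_
    have : 0 ≤ SS 1 f * Real.sqrt (SS 0 g * SS (0 + 1) g) := by positivity
    simp only [zero_add] at *
    nlinarith
  · have n0 := SS_nonneg 0 g
    have n1 := SS_nonneg 1 g
    have n2 := SS_nonneg 2 g
    have m01 : SS 0 g ≤ SS 1 g := by
      simp only [SS, Finset.sum_range_succ, Finset.sum_range_zero, zero_add]
      linarith [show 0 ≤ ∫ y in cube, ‖iteratedFDeriv ℝ 1 g y‖ ^ 2 from
        integral_nonneg fun y => by positivity]
    have m12 : SS 1 g ≤ SS 2 g := by
      simp only [SS, Finset.sum_range_succ, Finset.sum_range_zero, zero_add]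
      linarith [show 0 ≤ ∫ y in cube, ‖iteratedFDeriv ℝ 2 g y‖ ^ 2 from
        integral_nonneg fun y => by positivity]
    set Q := Real.sqrt (SS 1 g * SS 2 g) with hQ
    have e0' : SS 0 (fun y => f y * g y) ≤ B * SS 1 f * Q := by
      refine e0.trans ?_
      rw [hQ]
      gcongr
    have hj : ∀ j : Fin 3, ∫ y in cube, f y ^ 2 * fderiv ℝ g y (Pi.single j 1) ^ 2 ≤
        B * SS 1 f * Q := by
      intro j
      have hv : ‖(Pi.single j 1 : Fin 3 → ℝ)‖ ≤ 1 := by rw [Pi.norm_single, norm_one]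
      refine (hb f _ hf hfp (pd_smooth hg (Pi.single j 1)) (pd_per hgp (Pi.single j 1))).trans ?_
      obtain ⟨u1, u2⟩ := pd_SS hg hv
      have := SS_nonneg 1 (fun y => fderiv ℝ g y (Pi.single j 1))
      rw [hQ]
      gcongr
    have hgr : ∫ y in cube, ‖iteratedFDeriv ℝ 1 f y‖ ^ 2 ≤ SS 1 f := by
      simp only [SS, Finset.sum_range_succ, Finset.sum_range_zero, zero_add]
      linarith [show 0 ≤ ∫ y in cube, ‖iteratedFDeriv ℝ 0 f y‖ ^ 2 from
        integral_nonneg fun y => by positivity]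
    have cf := hf.continuous
    have c1 := cont_iter hf 1
    have cj : ∀ j : Fin 3, Continuous fun y => fderiv ℝ g y (Pi.single j 1) := fun j =>
      (pd_smooth hg _).continuous
    have e1 : ∫ y in cube, ‖iteratedFDeriv ℝ 1 (fun y => f y * g y) y‖ ^ 2 ≤
        6 * (3 * (B * SS 1 f * Q)) + 2 * (A * Q) * SS 1 f := by
      calc ∫ y in cube, ‖iteratedFDeriv ℝ 1 (fun y => f y * g y) y‖ ^ 2
          ≤ ∫ y in cube, (6 * (∑ j : Fin 3, f y ^ 2 * fderiv ℝ g y (Pi.single j 1) ^ 2) +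
            2 * (A * Q) * ‖iteratedFDeriv ℝ 1 f y‖ ^ 2) := by
            refine setIntegral_mono_on (cont_intOn ((cont_iter hfg 1).pow 2))
              (cont_intOn (by fun_prop)) cube_meas fun y hy => ?_
            have hs := ha g hg hgp y (by simpa using cube_sub hy)
            have hm := norm_iteratedFDeriv_mul_le (𝕜 := ℝ) (n := 1) hf hg y
              (by exact_mod_cast le_top)
            have hgd := grad_le (fderiv ℝ g y)
            simp only [Finset.sum_range_succ, Finset.sum_range_zero, zero_add,
              Nat.choose_zero_right, Nat.choose_self, Nat.cast_one, one_mul, Nat.sub_zero,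
              Nat.reduceSub, norm_iteratedFDeriv_zero, norm_iteratedFDeriv_one] at hm ⊢
            rw [← Finset.mul_sum]
            generalize (∑ j : Fin 3, fderiv ℝ g y (Pi.single j 1) ^ 2) = s at *
            have k1 : ‖fderiv ℝ (fun y => f y * g y) y‖ ^ 2 ≤
                (‖f y‖ * ‖fderiv ℝ g y‖ + ‖fderiv ℝ f y‖ * ‖g y‖) ^ 2 := by gcongr
            have k2 : (‖f y‖ * ‖fderiv ℝ g y‖ + ‖fderiv ℝ f y‖ * ‖g y‖) ^ 2 ≤
                2 * (f y ^ 2 * ‖fderiv ℝ g y‖ ^ 2) + 2 * (‖fderiv ℝ f y‖ ^ 2 * g y ^ 2) := by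
              refine add_sq_le.trans (le_of_eq ?_)
              rw [mul_pow, mul_pow, Real.norm_eq_abs, Real.norm_eq_abs, sq_abs, sq_abs]
              ring
            have k3 := mul_le_mul_of_nonneg_left hgd (sq_nonneg (f y))
            have k4 := mul_le_mul_of_nonneg_left hs (sq_nonneg ‖fderiv ℝ f y‖)
            linarith
        _ = 6 * (∑ j : Fin 3, ∫ y in cube, f y ^ 2 * fderiv ℝ g y (Pi.single j 1) ^ 2) +
            2 * (A * Q) * ∫ y in cube, ‖iteratedFDeriv ℝ 1 f y‖ ^ 2 := by
            rw [integral_add (cont_intOn (by fun_prop)) (cont_intOn (by fun_prop)),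
              integral_const_mul, integral_const_mul, integral_finsetSum]
            exact fun j _ => cont_intOn (by have := cj j; fun_prop)
        _ ≤ 6 * (∑ j : Fin 3, B * SS 1 f * Q) + 2 * (A * Q) * SS 1 f := by
            gcongr with j
            exact hj j
        _ = _ := by simp
    have split : SS 1 (fun y => f y * g y) = SS 0 (fun y => f y * g y) +
        ∫ y in cube, ‖iteratedFDeriv ℝ 1 (fun y => f y * g y) y‖ ^ 2 := by
      simp only [SS, Finset.sum_range_succ, Finset.sum_range_zero, zero_add]
    rw [split]
    change _ ≤ (B + 18 * B + 2 * A) * SS 1 f * Q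
    linarith

/-- Product estimate: for `0 ≤ i ≤ 1`,
`‖fg‖_{H^i} ≤ C ‖f‖_{H¹} (‖g‖_{H^i} ‖g‖_{H^{i+1}})^{1/2}`. -/
theorem product_sqrt_estimate :
    ∃ C : ℝ, 0 < C ∧ ∀ i : ℕ, i ≤ 1 → ∀ f g : (Fin 3 → ℝ) → ℝ,
      ContDiff ℝ (⊤ : ℕ∞) f → ZPeriodic f → ContDiff ℝ (⊤ : ℕ∞) g → ZPeriodic g →
      Hnorm i (fun y => f y * g y) ≤
        C * Hnorm 1 f * Real.sqrt (Hnorm i g * Hnorm (i + 1) g) := by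
  obtain ⟨C, hC, h⟩ := final_sq
  refine ⟨Real.sqrt C, Real.sqrt_pos.2 hC, fun i hi f g hf hfp hg hgp => ?_⟩
  have := Real.sqrt_le_sqrt (h i hi f g hf hfp hg hgp)
  change Real.sqrt (SS i _) ≤ Real.sqrt C * Real.sqrt (SS 1 f) *
    Real.sqrt (Real.sqrt (SS i g) * Real.sqrt (SS (i + 1) g))
  rw [← Real.sqrt_mul (SS_nonneg i g), ← Real.sqrt_mul hC.le,
    ← Real.sqrt_mul (mul_nonneg hC.le (SS_nonneg 1 f))]
  exact this
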